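/- arXiv:1812.08143 — 2 statements merged into one kernel-verified Lean document; each statement's English description precedes it below -/
import Mathlib

section
/- Let ℋ, 𝒦, ℰ, ℰ̃ be complex Hilbert spaces and let X : ℋ → 𝒦, Y : ℰ → 𝒦, Ỹ : ℰ̃ → 𝒦 be bounded linear maps such that both block operators [X Y] : ℋ ⊕ ℰ → 𝒦, (h,e) ↦ Xh + Ye, and [X Ỹ] : ℋ ⊕ ℰ̃ → 𝒦, (h,e) ↦ Xh + Ỹe, are unitary. Then there exists a unitary U : ℰ̃ → ℰ such that Ỹ = Y∘U. (In particular, any two characteristic triples (ℰ,B,D) and (ℰ̃,B̃,D̃) of a pure m-hypercontraction T satisfy B̃ = B U and D̃ = D U for a unitary U : ℰ̃ → ℰ.) -/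
/-- If `[X Y]` is unitary and `[X Y']` is isometric, then the range of `Y'` is contained in the
range of `Y`. -/
theorem range_le_range_of_block_isometry {H K E E' : Type*}
    [NormedAddCommGroup H] [InnerProductSpace ℂ H]
    [NormedAddCommGroup K] [InnerProductSpace ℂ K]
    [NormedAddCommGroup E] [InnerProductSpace ℂ E]
    [NormedAddCommGroup E'] [InnerProductSpace ℂ E']
    (X : H →L[ℂ] K) (Y : E →L[ℂ] K) (Y' : E' →L[ℂ] K)
    (hiso : ∀ (h : H) (e : E), ‖X h + Y e‖ ^ 2 = ‖h‖ ^ 2 + ‖e‖ ^ 2)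
    (hsurj : ∀ k : K, ∃ (h : H) (e : E), X h + Y e = k)
    (hiso' : ∀ (h : H) (e : E'), ‖X h + Y' e‖ ^ 2 = ‖h‖ ^ 2 + ‖e‖ ^ 2) :
    Y'.toLinearMap.range ≤ Y.toLinearMap.range := by
  rintro _ ⟨e, rfl⟩
  obtain ⟨h, f, hf⟩ := hsurj (Y' e)
  have h₁ : ‖e‖ ^ 2 = ‖h‖ ^ 2 + ‖f‖ ^ 2 := by
    rw [← hiso h f, hf]
    simpa using (hiso' 0 e).symm
  have h₂ : ‖f‖ ^ 2 = ‖h‖ ^ 2 + ‖e‖ ^ 2 := by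
    have key := hiso' (-h) e
    rw [← hf, map_neg, neg_add_cancel_left, norm_neg] at key
    rw [← key]
    simpa using (hiso 0 f).symm
  have h₀ : h = 0 := by
    have : ‖h‖ ^ 2 = 0 := by linarith
    simpa using this
  exact ⟨f, by simpa [h₀] using hf⟩

/-- If `[X Y] : ℋ ⊕ ℰ → 𝒦` and `[X Ỹ] : ℋ ⊕ ℰ̃ → 𝒦` are both unitary (i.e. isometric for
the ℓ²-product norms and surjective), then there is a unitary `U : ℰ̃ → ℰ` with `Ỹ = Y ∘ U`.
In particular, any two characteristic triples of a pure `m`-hypercontraction coincide up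
to a unitary. -/
theorem characteristic_triple_unique {H K E E' : Type*}
    [NormedAddCommGroup H] [InnerProductSpace ℂ H]
    [NormedAddCommGroup K] [InnerProductSpace ℂ K]
    [NormedAddCommGroup E] [InnerProductSpace ℂ E]
    [NormedAddCommGroup E'] [InnerProductSpace ℂ E']
    (X : H →L[ℂ] K) (Y : E →L[ℂ] K) (Y' : E' →L[ℂ] K)
    (hiso : ∀ (h : H) (e : E), ‖X h + Y e‖ ^ 2 = ‖h‖ ^ 2 + ‖e‖ ^ 2)
    (hsurj : ∀ k : K, ∃ (h : H) (e : E), X h + Y e = k)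
    (hiso' : ∀ (h : H) (e : E'), ‖X h + Y' e‖ ^ 2 = ‖h‖ ^ 2 + ‖e‖ ^ 2)
    (hsurj' : ∀ k : K, ∃ (h : H) (e : E'), X h + Y' e = k) :
    ∃ U : E' ≃ₗᵢ[ℂ] E, ∀ e : E', Y' e = Y (U e) := by
  have hY : ∀ e, ‖Y e‖ = ‖e‖ := fun e =>
    (sq_eq_sq₀ (norm_nonneg _) (norm_nonneg _)).1 (by simpa using hiso 0 e)
  have hY' : ∀ e, ‖Y' e‖ = ‖e‖ := fun e =>
    (sq_eq_sq₀ (norm_nonneg _) (norm_nonneg _)).1 (by simpa using hiso' 0 e)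
  let V : E →ₗᵢ[ℂ] K := ⟨Y.toLinearMap, hY⟩
  let V' : E' →ₗᵢ[ℂ] K := ⟨Y'.toLinearMap, hY'⟩
  have hrange : V'.toLinearMap.range = V.toLinearMap.range :=
    le_antisymm (range_le_range_of_block_isometry X Y Y' hiso hsurj hiso')
      (range_le_range_of_block_isometry X Y' Y hiso' hsurj' hiso)
  refine ⟨V'.equivRange.trans ((LinearIsometryEquiv.ofEq _ _ hrange).trans V.equivRange.symm),
    fun e => ?_⟩
  exact (congrArg Subtype.val (V.equivRange.apply_symm_apply
    (LinearIsometryEquiv.ofEq _ _ hrange (V'.equivRange e)))).symm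
end

section
/- Let β be a weight sequence with associated sequence γ, let ℰ be a complex Hilbert space, and let z ∈ 𝔹ⁿ. Then for every a = (a_𝐤)_{𝐤} ∈ ℓ²(ℤ₊ⁿ,ℰ) the family (√(ρ₁(𝐤)/γ_{|𝐤|}) z^𝐤 a_𝐤)_{𝐤∈ℤ₊ⁿ} is absolutely summable in ℰ, and the resulting linear map Ψ_{β,ℰ}(z) : ℓ²(ℤ₊ⁿ,ℰ) → ℰ, a ↦ Σ_𝐤 √(ρ₁(𝐤)/γ_{|𝐤|}) z^𝐤 a_𝐤, is bounded with ‖Ψ_{β,ℰ}(z) a‖ ≤ (Σ_{j≥0} γ_j^{−1} ‖z‖^{2j})^{1/2} ‖a‖. -/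
/-- `ρ_m(𝐤)`; in particular `ρ₁(𝐤) = |𝐤|!/𝐤!`. -/
noncomputable def rho {n : ℕ} (m : ℕ) (k : Fin n → ℕ) : ℝ :=
  if m = 0 then (if k = 0 then 1 else 0)
  else (Nat.factorial (m + (∑ i, k i) - 1) : ℝ) /
    (((∏ i, Nat.factorial (k i)) * Nat.factorial (m - 1) : ℕ) : ℝ)

open Finset in
/-- The number `ρ₁(𝐤)` is the multinomial coefficient of `𝐤`. -/
theorem rho_one_eq_multinomial {n : ℕ} (k : Fin n → ℕ) :
    rho 1 k = (Nat.multinomial univ k : ℝ) := by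
  have h := Nat.multinomial_spec univ k
  have hpos : (0 : ℝ) < ((∏ i, Nat.factorial (k i) : ℕ) : ℝ) := by
    exact_mod_cast prod_pos fun i _ => Nat.factorial_pos (k i)
  simp only [rho, one_ne_zero, if_false, Nat.add_sub_cancel_left, Nat.sub_self,
    Nat.factorial_zero, mul_one]
  rw [div_eq_iff hpos.ne', ← h]
  push_cast
  ring

open Finset in
/-- The multinomial theorem for `‖z‖ ^ (2 * j)`. -/
theorem sum_rho_one_mul_norm_prod_sq {n : ℕ} (z : EuclideanSpace ℂ (Fin n)) (j : ℕ) :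
    ∑ k ∈ piAntidiag univ j, rho 1 k * ‖∏ i, z i ^ k i‖ ^ 2 = ‖z‖ ^ (2 * j) := by
  rw [pow_mul, EuclideanSpace.norm_sq_eq, sum_pow_eq_sum_piAntidiag]
  refine sum_congr rfl fun k _ => ?_
  rw [rho_one_eq_multinomial, norm_prod, ← prod_pow]
  congr 1
  refine prod_congr rfl fun i _ => ?_
  rw [norm_pow, ← pow_mul, ← pow_mul, mul_comm]

/-- If `liminf β_j^{1/j} ≥ 1` then `β` eventually dominates every geometric sequence of
ratio `s < 1`. -/
theorem eventually_pow_lt_of_one_le_liminf {β : ℕ → ℝ} (hpos : ∀ j, 0 < β j)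
    (hlim : 1 ≤ Filter.liminf (fun j : ℕ => (β j) ^ (1 / (j : ℝ))) Filter.atTop)
    {s : ℝ} (hs0 : 0 < s) (hs : s < 1) :
    ∀ᶠ j in Filter.atTop, s ^ j < β j := by
  have hbdd : Filter.IsBoundedUnder (· ≥ ·) Filter.atTop
      (fun j : ℕ => (β j) ^ (1 / (j : ℝ))) :=
    Filter.isBoundedUnder_of ⟨0, fun j => Real.rpow_nonneg (hpos j).le _⟩
  filter_upwards [Filter.eventually_lt_of_lt_liminf (hs.trans_le hlim) hbdd,
    Filter.eventually_gt_atTop 0] with j hj hj0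
  calc s ^ j < ((β j) ^ (1 / (j : ℝ))) ^ j := pow_lt_pow_left₀ hj hs0.le hj0.ne'
    _ = β j := by rw [one_div, Real.rpow_inv_natCast_pow (hpos j).le hj0.ne']

/-- If nonnegative `c_j ≤ 1/β_j` and `liminf β_j^{1/j} ≥ 1`, then `∑ c_j x^j` converges for
`0 ≤ x < 1`. -/
theorem summable_mul_pow_of_one_le_liminf {β c : ℕ → ℝ} (hpos : ∀ j, 0 < β j)
    (hlim : 1 ≤ Filter.liminf (fun j : ℕ => (β j) ^ (1 / (j : ℝ))) Filter.atTop)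
    (hc0 : ∀ j, 0 ≤ c j) (hc : ∀ j, c j ≤ 1 / β j) {x : ℝ} (hx0 : 0 ≤ x) (hx : x < 1) :
    Summable fun j => c j * x ^ j := by
  obtain ⟨s, hxs, hs⟩ := exists_between hx
  have hs0 : 0 < s := hx0.trans_lt hxs
  have hgeo : Summable fun j : ℕ => (x / s) ^ j :=
    summable_geometric_of_lt_one (by positivity) ((div_lt_one hs0).2 hxs)
  refine hgeo.of_norm_bounded_eventually_nat ?_
  filter_upwards [eventually_pow_lt_of_one_le_liminf hpos hlim hs0 hs] with j hj
  rw [Real.norm_of_nonneg (mul_nonneg (hc0 j) (by positivity)), div_pow, div_eq_inv_mul]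
  gcongr
  exact (hc j).trans (by rw [one_div]; exact inv_anti₀ (by positivity) hj.le)

open Finset in
/-- A nonnegative family on `ℤ₊ⁿ` is bounded, on finite sets, by the sum of its homogeneous
parts. -/
theorem sum_le_tsum_of_sum_piAntidiag {n : ℕ} {f : (Fin n → ℕ) → ℝ} {g : ℕ → ℝ}
    (hf : ∀ k, 0 ≤ f k) (hfg : ∀ j, ∑ k ∈ piAntidiag univ j, f k = g j) (hg : Summable g)
    (u : Finset (Fin n → ℕ)) : ∑ k ∈ u, f k ≤ ∑' j, g j := by
  have hg0 : ∀ j, 0 ≤ g j := fun j => hfg j ▸ sum_nonneg fun k _ => hf k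
  calc ∑ k ∈ u, f k
      = ∑ j ∈ u.image fun k => ∑ i, k i, ∑ k ∈ u with ∑ i, k i = j, f k :=
        (sum_fiberwise_of_maps_to (fun k hk => mem_image_of_mem _ hk) f).symm
    _ ≤ ∑ j ∈ u.image fun k => ∑ i, k i, g j := by
        refine sum_le_sum fun j _ => ?_
        rw [← hfg j]
        refine sum_le_sum_of_subset_of_nonneg (fun k hk => ?_) fun k _ _ => hf k
        simpa [mem_piAntidiag] using (mem_filter.1 hk).2
    _ ≤ ∑' j, g j := hg.sum_le_tsum _ fun j _ => hg0 j

/-- Cauchy–Schwarz for a scalar family with square sum at most `C` acting on `ℓ²`. -/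
theorem summable_norm_smul_and_norm_tsum_le {ι E : Type*} [NormedAddCommGroup E]
    [NormedSpace ℂ E] {c : ι → ℂ} {C : ℝ}
    (hc : ∀ u : Finset ι, ∑ k ∈ u, ‖c k‖ ^ 2 ≤ C) (a : lp (fun _ : ι => E) 2) :
    Summable (fun k => ‖c k • a k‖) ∧ ‖∑' k, c k • a k‖ ≤ Real.sqrt C * ‖a‖ := by
  have hcs : Summable fun k => ‖c k‖ ^ (2 : ℝ) := by
    simpa using summable_of_sum_le (fun k => sq_nonneg ‖c k‖) hc
  have hct : ∑' k, ‖c k‖ ^ (2 : ℝ) ≤ C := by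
    simpa using Real.tsum_le_of_sum_le (fun k => sq_nonneg ‖c k‖) hc
  have has : Summable fun k => ‖a k‖ ^ (2 : ℝ) := by
    simpa using (lp.memℓp a).summable (by norm_num)
  have hna : ‖a‖ = (∑' k, ‖a k‖ ^ (2 : ℝ)) ^ (1 / (2 : ℝ)) := by
    simpa using lp.norm_eq_tsum_rpow (p := 2) (by norm_num) a
  obtain ⟨hs, hle⟩ := Real.summable_and_inner_le_Lp_mul_Lq_tsum_of_nonneg Real.HolderConjugate.two_two
    (fun k => norm_nonneg (c k)) (fun k => norm_nonneg (a k)) hcs has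
  have hsn : Summable fun k => ‖c k • a k‖ := by simpa only [norm_smul] using hs
  refine ⟨hsn, (norm_tsum_le_tsum_norm hsn).trans ?_⟩
  simp only [norm_smul]
  refine hle.trans ?_
  rw [hna, ← Real.sqrt_eq_rpow]
  gcongr

/-- For a weight sequence `β` with associated sequence `γ`, a Hilbert space `ℰ` and
`z ∈ 𝔹ⁿ`, for every `a ∈ ℓ²(ℤ₊ⁿ,ℰ)` the family `(√(ρ₁(𝐤)/γ_{|𝐤|}) z^𝐤 a_𝐤)_𝐤` is
absolutely summable, and the resulting map `Ψ_{β,ℰ}(z)` satisfies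
`‖Ψ_{β,ℰ}(z) a‖ ≤ (Σ_j γ_j⁻¹ ‖z‖^{2j})^{1/2} ‖a‖`. -/
theorem universal_multiplier_bound {n : ℕ} {E : Type*}
    [NormedAddCommGroup E] [InnerProductSpace ℂ E] [CompleteSpace E]
    (β γ : ℕ → ℝ)
    (hβpos : ∀ j, 0 < β j) (hβanti : StrictAnti β) (hβ0 : β 0 = 1)
    (hβliminf : 1 ≤ Filter.liminf (fun j : ℕ => (β j) ^ (1 / (j : ℝ))) Filter.atTop)
    (hγ0 : γ 0 = 1)
    (hγ : ∀ j : ℕ, 1 ≤ j → γ j = (1 / β j - 1 / β (j - 1))⁻¹)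
    (z : EuclideanSpace ℂ (Fin n)) (hz : z ∈ Metric.ball (0 : EuclideanSpace ℂ (Fin n)) 1)
    (a : lp (fun _ : Fin n → ℕ => E) 2) :
    Summable (fun k : Fin n → ℕ =>
      ‖((Real.sqrt (rho 1 k / γ (∑ i, k i)) : ℂ) * ∏ i, z i ^ k i) • a k‖) ∧
    Summable (fun j : ℕ => (γ j)⁻¹ * ‖z‖ ^ (2 * j)) ∧
    ‖∑' k : Fin n → ℕ,
        ((Real.sqrt (rho 1 k / γ (∑ i, k i)) : ℂ) * ∏ i, z i ^ k i) • a k‖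
      ≤ Real.sqrt (∑' j : ℕ, (γ j)⁻¹ * ‖z‖ ^ (2 * j)) * ‖a‖ := by
  have hinv : ∀ j, 1 ≤ j → (γ j)⁻¹ = 1 / β j - 1 / β (j - 1) := fun j hj => by
    rw [hγ j hj, inv_inv]
  have hγnonneg : ∀ j, 0 ≤ (γ j)⁻¹ := by
    intro j
    rcases Nat.eq_zero_or_pos j with rfl | hj
    · simp [hγ0]
    · rw [hinv j hj, sub_nonneg]
      exact one_div_le_one_div_of_le (hβpos j) (hβanti (Nat.sub_lt hj one_pos)).le
  have hγle : ∀ j, (γ j)⁻¹ ≤ 1 / β j := by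
    intro j
    rcases Nat.eq_zero_or_pos j with rfl | hj
    · simp [hγ0, hβ0]
    · rw [hinv j hj]
      exact sub_le_self _ (one_div_pos.2 (hβpos _)).le
  have hz1 : ‖z‖ < 1 := by simpa using hz
  have hsum : Summable fun j : ℕ => (γ j)⁻¹ * ‖z‖ ^ (2 * j) := by
    simpa only [pow_mul] using summable_mul_pow_of_one_le_liminf hβpos hβliminf hγnonneg hγle
      (sq_nonneg ‖z‖) (pow_lt_one₀ (norm_nonneg z) hz1 two_ne_zero)
  have hnorm : ∀ k : Fin n → ℕ,
      ‖(Real.sqrt (rho 1 k / γ (∑ i, k i)) : ℂ) * ∏ i, z i ^ k i‖ ^ 2 =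
        (γ (∑ i, k i))⁻¹ * (rho 1 k * ‖∏ i, z i ^ k i‖ ^ 2) := by
    intro k
    have hnonneg : 0 ≤ rho 1 k / γ (∑ i, k i) := by
      rw [div_eq_mul_inv, rho_one_eq_multinomial]
      exact mul_nonneg (Nat.cast_nonneg _) (hγnonneg _)
    rw [norm_mul, mul_pow, Complex.norm_real, Real.norm_eq_abs, sq_abs, Real.sq_sqrt hnonneg]
    ring
  have hbound := sum_le_tsum_of_sum_piAntidiag (n := n) (fun k => sq_nonneg
    ‖(Real.sqrt (rho 1 k / γ (∑ i, k i)) : ℂ) * ∏ i, z i ^ k i‖) (fun j => by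
      rw [← sum_rho_one_mul_norm_prod_sq, Finset.mul_sum]
      refine Finset.sum_congr rfl fun k hk => ?_
      rw [hnorm, (Finset.mem_piAntidiag.1 hk).1]) hsum
  obtain ⟨h1, h2⟩ := summable_norm_smul_and_norm_tsum_le hbound a
  exact ⟨h1, hsum, h2⟩
end
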